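/- arXiv:1811.10926 — 2 statements merged into one kernel-verified Lean document; each statement's English description precedes it below -/
import Mathlib

section
/- Let ι : ℂ[θ₁, θ₂, θ₃, θ₄, A₁, A₁₂, A₂, A₂₃, A₃, A₃₄, A₄, A₄₁, λ₁₃, λ₂₄] → R₁₈ be the inclusion of polynomial rings induced by the inclusion of these 14 variables among the 18. Then the preimage ideal ι⁻¹(I_{G₂}) (the elimination ideal of I_{G₂} with respect to the variables θ₁₂, θ₂₃, θ₃₄, θ₄₁) is generated by the two elements θ₁θ₃ − A₁₂A₂A₂₃θ₂ − λ₂₄A₁₂A₂₃A₃₄A₄₁ − A₃₄A₄A₄₁θ₄ and θ₂θ₄ − A₄₁A₁A₁₂θ₁ − λ₁₃A₁₂A₂₃A₃₄A₄₁ − A₂₃A₃A₃₄θ₃. In other words, the Gorenstein projection of X_{G₂} eliminating θ₁₂, θ₂₃, θ₃₄, θ₄₁ is a complete intersection of codimension 2. -/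
/-!
The G₂ cluster variety.

`R18` is the polynomial ring over ℂ in the 18 variables, indexed as follows:
`0 ↦ θ₁, 1 ↦ θ₁₂, 2 ↦ θ₂, 3 ↦ θ₂₃, 4 ↦ θ₃, 5 ↦ θ₃₄, 6 ↦ θ₄, 7 ↦ θ₄₁,
 8 ↦ A₁, 9 ↦ A₁₂, 10 ↦ A₂, 11 ↦ A₂₃, 12 ↦ A₃, 13 ↦ A₃₄, 14 ↦ A₄, 15 ↦ A₄₁,
 16 ↦ λ₁₃, 17 ↦ λ₂₄`.
Indices `i : Fin 4` stand for the indices 1,2,3,4 taken modulo 4, with `Fin 4` addition.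
-/

open MvPolynomial

noncomputable section

abbrev R18 : Type := MvPolynomial (Fin 18) ℂ

/-- The cluster variables θ₁, θ₂, θ₃, θ₄. -/
def th : Fin 4 → R18 := ![X 0, X 2, X 4, X 6]

/-- The cluster variables θ₁₂, θ₂₃, θ₃₄, θ₄₁ : `thp i = θ_{i,i+1}`. -/
def thp : Fin 4 → R18 := ![X 1, X 3, X 5, X 7]

/-- The coefficients A₁, A₂, A₃, A₄. -/
def aS : Fin 4 → R18 := ![X 8, X 10, X 12, X 14]

/-- The coefficients A₁₂, A₂₃, A₃₄, A₄₁ : `aP i = A_{i,i+1}`. -/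
def aP : Fin 4 → R18 := ![X 9, X 11, X 13, X 15]

/-- The parameters: `lam i = λ_{i,i+2}`, so `λ₁₃ = lam 0 = lam 2` and
`λ₂₄ = lam 1 = lam 3` (unordered pairs of opposite indices). -/
def lam : Fin 4 → R18 := ![X 16, X 17, X 16, X 17]

/-- `θ_{xy}` for *adjacent* `x y : Fin 4` (unordered pair: `θ_{xy} = θ_{yx}`). -/
def thpp (x y : Fin 4) : R18 := if y = x + 1 then thp x else thp y

/-- `A_{xy}` for *adjacent* `x y : Fin 4` (unordered pair: `A_{xy} = A_{yx}`). -/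
def aPP (x y : Fin 4) : R18 := if y = x + 1 then aP x else aP y

/-- The dihedral permutation `(i,j,k,l)` of `(1,2,3,4)` starting at `s` with direction `d`:
position `t` is sent to `s + t` (if `d`) or `s - t` (otherwise). The eight choices of
`(s, d)` give the eight dihedral permutations (cyclic rotations and their reversals). -/
def dih (s : Fin 4) (d : Bool) (t : Fin 4) : Fin 4 := if d then s + t else s - t

/-- Family 1: `θᵢθⱼ − A_{ij}θ_{ij} − A_{jk}A_kA_{kl}²A_lA_{li}` (4 distinct equations). -/
def f1 (s : Fin 4) (d : Bool) : R18 :=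
  let i := dih s d 0; let j := dih s d 1; let k := dih s d 2; let l := dih s d 3
  th i * th j - aPP i j * thpp i j - aPP j k * aS k * aPP k l ^ 2 * aS l * aPP l i

/-- Family 2: `θ_{ij}θ_{jk} − A_jθⱼ³ − λ_{jl}A_{kl}A_{li}θⱼ² − λ_{ik}A_{kl}²A_lA_{li}²θⱼ
− A_kA_{kl}³A_l²A_{li}³A_i` (4 distinct equations). -/
def f2 (s : Fin 4) (d : Bool) : R18 :=
  let i := dih s d 0; let j := dih s d 1; let k := dih s d 2; let l := dih s d 3
  thpp i j * thpp j k - aS j * th j ^ 3 - lam j * aPP k l * aPP l i * th j ^ 2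
    - lam i * aPP k l ^ 2 * aS l * aPP l i ^ 2 * th j
    - aS k * aPP k l ^ 3 * aS l ^ 2 * aPP l i ^ 3 * aS i

/-- Family 3: `θᵢθ_{jk} − A_{ij}A_jθⱼ² − λ_{jl}A_{kl}A_{li}A_{ij}θⱼ − λ_{ik}A_{kl}²A_lA_{li}²A_{ij}
− A_kA_{kl}²A_lA_{li}θ_k` (8 distinct equations). -/
def f3 (s : Fin 4) (d : Bool) : R18 :=
  let i := dih s d 0; let j := dih s d 1; let k := dih s d 2; let l := dih s d 3
  th i * thpp j k - aPP i j * aS j * th j ^ 2 - lam j * aPP k l * aPP l i * aPP i j * th j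
    - lam i * aPP k l ^ 2 * aS l * aPP l i ^ 2 * aPP i j
    - aS k * aPP k l ^ 2 * aS l * aPP l i * th k

/-- Family 4: `θᵢθ_k − A_{ij}A_jA_{jk}θⱼ − λ_{jl}A_{ij}A_{jk}A_{kl}A_{li} − A_{kl}A_lA_{li}θ_l`
(2 distinct equations). -/
def f4 (s : Fin 4) (d : Bool) : R18 :=
  let i := dih s d 0; let j := dih s d 1; let k := dih s d 2; let l := dih s d 3
  th i * th k - aPP i j * aS j * aPP j k * th j
    - lam j * aPP i j * aPP j k * aPP k l * aPP l i - aPP k l * aS l * aPP l i * th l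

/-- Family 5: `θ_{ij}θ_{kl} − A_jA_{jk}²A_kθⱼθ_k − A_{li}A_{jk}(λ_{ik}θᵢθ_k + λ_{jl}θⱼθ_l)
− A_lA_{li}²A_iθ_lθᵢ − A_{ij}A_{jk}²A_{kl}A_{li}²(A_iA_jA_kA_l − λ_{ik}λ_{jl})`
(2 distinct equations). -/
def f5 (s : Fin 4) (d : Bool) : R18 :=
  let i := dih s d 0; let j := dih s d 1; let k := dih s d 2; let l := dih s d 3
  thpp i j * thpp k l - aS j * aPP j k ^ 2 * aS k * th j * th k
    - aPP l i * aPP j k * (lam i * th i * th k + lam j * th j * th l)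
    - aS l * aPP l i ^ 2 * aS i * th l * th i
    - aPP i j * aPP j k ^ 2 * aPP k l * aPP l i ^ 2
        * (aS i * aS j * aS k * aS l - lam i * lam j)

/-- All the generators of the G₂ cluster ideal, indexed by the family (`Fin 5`) and the
dihedral permutation (`Fin 4 × Bool`).  As permutations in the same dihedral orbit of an
equation give the same polynomial, the set of values of this family consists of the twenty
defining polynomials (4 + 4 + 8 + 2 + 2). -/
def genG2 : Fin 5 → Fin 4 → Bool → R18 := ![f1, f2, f3, f4, f5]

/-- The G₂ cluster ideal, generated by the twenty relations. -/
def IG2 : Ideal R18 :=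
  Ideal.span (Set.range (fun x : Fin 5 × Fin 4 × Bool => genG2 x.1 x.2.1 x.2.2))

/-- The G₂ cluster variety `X_{G₂} ⊆ ℂ¹⁸`: the common zero locus of the twenty generators. -/
def XG2 : Set (Fin 18 → ℂ) :=
  {p | ∀ (m : Fin 5) (s : Fin 4) (d : Bool), eval p (genG2 m s d) = 0}

/-- The eight cluster variables θ₁, θ₁₂, θ₂, θ₂₃, θ₃, θ₃₄, θ₄, θ₄₁. -/
def clusterVar : Fin 8 → R18 := ![X 0, X 1, X 2, X 3, X 4, X 5, X 6, X 7]

end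

noncomputable section

/-- `R14 = ℂ[θ₁, θ₂, θ₃, θ₄, A₁, A₁₂, A₂, A₂₃, A₃, A₃₄, A₄, A₄₁, λ₁₃, λ₂₄]`, indexed as
`0 ↦ θ₁, 1 ↦ θ₂, 2 ↦ θ₃, 3 ↦ θ₄, 4 ↦ A₁, 5 ↦ A₁₂, 6 ↦ A₂, 7 ↦ A₂₃, 8 ↦ A₃, 9 ↦ A₃₄,
 10 ↦ A₄, 11 ↦ A₄₁, 12 ↦ λ₁₃, 13 ↦ λ₂₄`. -/
abbrev R14 : Type := MvPolynomial (Fin 14) ℂ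

/-- The inclusion of the 14 variables `θ₁, θ₂, θ₃, θ₄, A₁, A₁₂, A₂, A₂₃, A₃, A₃₄, A₄, A₄₁,
λ₁₃, λ₂₄` among the 18 variables of `R18`. -/
def emb18 : Fin 14 → Fin 18 := ![0, 2, 4, 6, 8, 9, 10, 11, 12, 13, 14, 15, 16, 17]

/-- `θ₁θ₃ − A₁₂A₂A₂₃θ₂ − λ₂₄A₁₂A₂₃A₃₄A₄₁ − A₃₄A₄A₄₁θ₄`. -/
def proj18a : R14 :=
  X 0 * X 2 - X 5 * X 6 * X 7 * X 1 - X 13 * X 5 * X 7 * X 9 * X 11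
    - X 9 * X 10 * X 11 * X 3

/-- `θ₂θ₄ − A₄₁A₁A₁₂θ₁ − λ₁₃A₁₂A₂₃A₃₄A₄₁ − A₂₃A₃A₃₄θ₃`. -/
def proj18b : R14 :=
  X 1 * X 3 - X 11 * X 4 * X 5 * X 0 - X 12 * X 5 * X 7 * X 9 * X 11
    - X 7 * X 8 * X 9 * X 2

end

/-- The point of `K¹⁸` over `(t, a, b)` (the values of `θᵢ`, `Aᵢ` and `A_{i,i+1}`), obtained by
solving the relations of families 1 and 4 for the `θ_{i,i+1}` and for `λ₁₃`, `λ₂₄`. -/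
def solvedPoint {K : Type*} [Field K] (t a b : Fin 4 → K) : Fin 18 → K :=
  ![t 0, (t 0 * t 1 - b 1 * a 2 * b 2 ^ 2 * a 3 * b 3) / b 0,
    t 1, (t 1 * t 2 - b 2 * a 3 * b 3 ^ 2 * a 0 * b 0) / b 1,
    t 2, (t 2 * t 3 - b 3 * a 0 * b 0 ^ 2 * a 1 * b 1) / b 2,
    t 3, (t 3 * t 0 - b 0 * a 1 * b 1 ^ 2 * a 2 * b 2) / b 3,
    a 0, b 0, a 1, b 1, a 2, b 2, a 3, b 3,
    (t 1 * t 3 - b 3 * a 0 * b 0 * t 0 - b 1 * a 2 * b 2 * t 2) / (b 0 * b 1 * b 2 * b 3),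
    (t 0 * t 2 - b 0 * a 1 * b 1 * t 1 - b 2 * a 3 * b 3 * t 3) / (b 0 * b 1 * b 2 * b 3)]

set_option maxHeartbeats 1000000 in
theorem aeval_solvedPoint_genG2 {K : Type*} [Field K] [Algebra ℂ K] (t a b : Fin 4 → K)
    (hb : ∀ i, b i ≠ 0) (m : Fin 5) (s : Fin 4) (d : Bool) :
    aeval (solvedPoint t a b) (genG2 m s d) = 0 := by
  have h0 := hb 0
  have h1 := hb 1
  have h2 := hb 2
  have h3 := hb 3
  have e1 : (-1 : Fin 4) = 3 := rfl
  have e2 : (-2 : Fin 4) = 2 := rfl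
  have e3 : (-3 : Fin 4) = 1 := rfl
  fin_cases m <;> fin_cases s <;> cases d <;>
    simp [genG2, f1, f2, f3, f4, f5, dih, thpp, aPP, th, thp, aS, aP, lam, solvedPoint,
      e1, e2, e3] <;>
    field_simp <;> ring

theorem mem_span_pair_of_mul_mem {R : Type*} [CommRing R] [IsDomain R] {x a b q : R}
    (ε : R →+* R) (hx : x ≠ 0) (hεx : ε x = 0) (hε : ∀ r, x ∣ r - ε r)
    (ha : Prime (ε a)) (hab : ¬ ε a ∣ ε b) (h : x * q ∈ Ideal.span {a, b}) :
    q ∈ Ideal.span {a, b} := by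
  obtain ⟨u, v, huv⟩ := Ideal.mem_span_pair.1 h
  have h0 : ε u * ε a + ε v * ε b = 0 := by
    rw [← map_mul, ← map_mul, ← map_add, huv, map_mul, hεx, zero_mul]
  obtain ⟨w, hw⟩ : ε a ∣ ε v :=
    (ha.dvd_or_dvd ⟨-ε u, by linear_combination h0⟩).resolve_right hab
  have hu : ε u = -(w * ε b) :=
    mul_left_cancel₀ ha.ne_zero (by linear_combination h0 - ε b * hw)
  obtain ⟨a', ha'⟩ := hε a
  obtain ⟨b', hb'⟩ := hε b
  obtain ⟨u', hu'⟩ := hε u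
  obtain ⟨v', hv'⟩ := hε v
  refine Ideal.mem_span_pair.2 ⟨u' + w * b', v' - w * a', mul_left_cancel₀ hx ?_⟩
  linear_combination huv - a * hu' - b * hv' - a * hu - b * hw - w * a * hb' + w * b * ha'

theorem X_dvd_sub_aeval_update_zero {σ R : Type*} [CommRing R] [DecidableEq σ] (i : σ)
    (p : MvPolynomial σ R) :
    (X i : MvPolynomial σ R) ∣ p - aeval (Function.update X i 0) p := by
  induction p using MvPolynomial.induction_on with
  | C r => simp
  | add p q hp hq =>
    rw [map_add, add_sub_add_comm]
    exact dvd_add hp hq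
  | mul_X p j hp =>
    have hj : (X i : MvPolynomial σ R) ∣ X j - Function.update X i 0 j := by
      by_cases h : j = i
      · subst h; simp
      · simp [h]
    rw [map_mul, aeval_X,
      show p * X j - aeval (Function.update X i 0) p * Function.update X i 0 j =
        (p - aeval (Function.update X i 0) p) * X j +
          aeval (Function.update X i 0) p * (X j - Function.update X i 0 j) by ring]
    exact dvd_add (hp.mul_right _) (hj.mul_left _)

theorem prime_X_mul_X_sub {i j k l m n : Fin 14} (hij : i ≠ j) (hi : i ∉ [k, l, m, n])
    (hj : j ∉ [k, l, m, n]) :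
    Prime (X i * X j - X k * X l * X m * X n : R14) := by
  simp only [List.mem_cons, List.not_mem_nil, or_false, not_or] at hi hj
  refine Irreducible.prime ?_
  have hX : Prime (X j : R14) := X_prime
  rw [sub_eq_add_neg, mul_comm (X i)]
  refine irreducible_mul_X_add _ _ _ (X_ne_zero _) (by simpa [vars_X] using hij) ?_ ?_
  · rw [vars_neg]
    intro h
    rcases Finset.mem_union.1 (vars_mul _ _ h) with h | h
    · rcases Finset.mem_union.1 (vars_mul _ _ h) with h | h
      · rcases Finset.mem_union.1 (vars_mul _ _ h) with h | h <;> simp_all [vars_X]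
      · simp_all [vars_X]
    · simp_all [vars_X]
  · rw [hX.irreducible.isRelPrime_iff_not_dvd, dvd_neg]
    simp [X_dvd_mul_iff, X_dvd_X, hj]

theorem not_dvd_of_eval {f g : R14} (v : Fin 14 → ℂ) (hf : eval v f = 0) (hg : eval v g ≠ 0) :
    ¬ f ∣ g := by
  rintro ⟨h, rfl⟩
  simp [hf] at hg

theorem mem_span_of_X_mul_mem {i : Fin 14} (hi : i ∈ ({5, 7, 9, 11} : Finset (Fin 14)))
    {q : R14} (h : X i * q ∈ Ideal.span {proj18a, proj18b}) :
    q ∈ Ideal.span {proj18a, proj18b} := by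
  refine mem_span_pair_of_mul_mem (aeval (Function.update X i 0) : R14 →ₐ[ℂ] R14).toRingHom
    (X_ne_zero i) (by simp) (X_dvd_sub_aeval_update_zero i) ?_ ?_ h
  · have h12 : Prime (X 0 * X 2 - X 9 * X 10 * X 11 * X 3 : R14) :=
      prime_X_mul_X_sub (by decide) (by decide) (by decide)
    have h34 : Prime (X 0 * X 2 - X 5 * X 6 * X 7 * X 1 : R14) :=
      prime_X_mul_X_sub (by decide) (by decide) (by decide)
    fin_cases hi
    · convert h12 using 1
      simp [proj18a]
    · convert h12 using 1
      simp [proj18a]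
    · convert h34 using 1
      simp [proj18a]
    · convert h34 using 1
      simp [proj18a]
  · apply not_dvd_of_eval ![0, 1, 0, 1, 0, 0, 0, 0, 0, 0, 0, 0, 0, 0] <;>
      fin_cases hi <;> simp [proj18a, proj18b]

/-- The product `A₁₂A₂₃A₃₄A₄₁`. -/
noncomputable def prodA : R14 := X 5 * X 7 * X 9 * X 11

theorem mem_span_of_prodA_pow_mul_mem (n : ℕ) {q : R14}
    (h : prodA ^ n * q ∈ Ideal.span {proj18a, proj18b}) :
    q ∈ Ideal.span {proj18a, proj18b} := by
  induction n with
  | zero => simpa using h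
  | succ n ih =>
    refine ih ?_
    apply mem_span_of_X_mul_mem (i := 5) (by decide)
    apply mem_span_of_X_mul_mem (i := 7) (by decide)
    apply mem_span_of_X_mul_mem (i := 9) (by decide)
    apply mem_span_of_X_mul_mem (i := 11) (by decide)
    convert h using 1
    rw [pow_succ, prodA]
    ring

/-- Setting the two parameters `λ₁₃` and `λ₂₄` to zero. -/
noncomputable def killLam : R14 →ₐ[ℂ] R14 := aeval fun i => if i = 12 ∨ i = 13 then 0 else X i

/-- Modulo `proj18a` and `proj18b`, each variable times `A₁₂A₂₃A₃₄A₄₁` can be rewritten without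
`λ₁₃` and `λ₂₄`. -/
theorem exists_prodA_mul_X_sub_mem (i : Fin 14) :
    ∃ q, prodA * X i - killLam q ∈ Ideal.span {proj18a, proj18b} := by
  by_cases h12 : i = 12
  · refine ⟨X 1 * X 3 - X 11 * X 4 * X 5 * X 0 - X 7 * X 8 * X 9 * X 2,
      Ideal.mem_span_pair.2 ⟨0, -1, ?_⟩⟩
    subst h12
    simp [killLam, prodA, proj18b]
    ring
  by_cases h13 : i = 13
  · refine ⟨X 0 * X 2 - X 5 * X 6 * X 7 * X 1 - X 9 * X 10 * X 11 * X 3,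
      Ideal.mem_span_pair.2 ⟨-1, 0, ?_⟩⟩
    subst h13
    simp [killLam, prodA, proj18a]
    ring
  · exact ⟨prodA * X i, by simp [killLam, prodA, h12, h13]⟩

theorem exists_prodA_pow_mul_sub_mem (p : R14) :
    ∃ (n : ℕ) (q : R14), prodA ^ n * p - killLam q ∈ Ideal.span {proj18a, proj18b} := by
  induction p using MvPolynomial.induction_on with
  | C r => exact ⟨0, C r, by simp [killLam, algebraMap_eq]⟩
  | add p p' hp hp' =>
    obtain ⟨n, q, h⟩ := hp
    obtain ⟨n', q', h'⟩ := hp'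
    have hM : killLam prodA = prodA := by simp [killLam, prodA]
    refine ⟨n + n', prodA ^ n' * q + prodA ^ n * q', ?_⟩
    convert add_mem (Ideal.mul_mem_left _ (prodA ^ n') h) (Ideal.mul_mem_left _ (prodA ^ n) h')
      using 1
    simp only [map_add, map_mul, map_pow, hM]
    ring
  | mul_X p i hp =>
    obtain ⟨n, q, h⟩ := hp
    obtain ⟨q', h'⟩ := exists_prodA_mul_X_sub_mem i
    refine ⟨n + 1, q * q', ?_⟩
    convert add_mem (Ideal.mul_mem_left _ (prodA * X i) h) (Ideal.mul_mem_left _ (killLam q) h')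
      using 1
    rw [map_mul]
    ring

/-- The evaluation of `R18` at the generic solution over the fraction field of `R14`. -/
noncomputable def toFrac : R18 →ₐ[ℂ] FractionRing R14 :=
  aeval (solvedPoint (fun i => algebraMap R14 _ (![X 0, X 1, X 2, X 3] i))
    (fun i => algebraMap R14 _ (![X 4, X 6, X 8, X 10] i))
    (fun i => algebraMap R14 _ (![X 5, X 7, X 9, X 11] i)))

theorem IG2_le_ker_toFrac : IG2 ≤ RingHom.ker toFrac := by
  rw [IG2, Ideal.span_le]
  rintro _ ⟨x, rfl⟩
  refine aeval_solvedPoint_genG2 _ _ _ (fun i => ?_) _ _ _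
  rw [Ne, FaithfulSMul.algebraMap_eq_zero_iff]
  fin_cases i <;> exact X_ne_zero _

theorem toFrac_rename_killLam (q : R14) :
    toFrac (rename emb18 (killLam q)) = algebraMap R14 _ (killLam q) := by
  suffices h : (toFrac.comp (rename emb18)).comp killLam =
      (IsScalarTower.toAlgHom ℂ R14 (FractionRing R14)).comp killLam from
    DFunLike.congr_fun h q
  ext i
  fin_cases i <;> simp [killLam, toFrac, solvedPoint, emb18]

theorem rename_proj18a : rename emb18 proj18a = genG2 3 0 true := by
  simp [proj18a, genG2, f4, emb18, dih, aPP, th, aS, aP, lam]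

theorem rename_proj18b : rename emb18 proj18b = genG2 3 1 true := by
  simp [proj18b, genG2, f4, emb18, dih, aPP, th, aS, aP, lam]
  ring

theorem span_proj18_le_comap :
    Ideal.span {proj18a, proj18b} ≤
      Ideal.comap (MvPolynomial.rename emb18 : R14 →ₐ[ℂ] R18) IG2 := by
  rw [Ideal.span_le, Set.pair_subset_iff]
  constructor
  · change rename emb18 proj18a ∈ IG2
    rw [rename_proj18a]
    exact Ideal.subset_span ⟨(3, 0, true), rfl⟩
  · change rename emb18 proj18b ∈ IG2
    rw [rename_proj18b]
    exact Ideal.subset_span ⟨(3, 1, true), rfl⟩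

/-- Let `ι : R14 → R18` be the inclusion of polynomial rings induced by the
inclusion of the 14 variables `θ₁, θ₂, θ₃, θ₄, A₁, A₁₂, A₂, A₂₃, A₃, A₃₄, A₄, A₄₁, λ₁₃, λ₂₄`
among the 18.  Then the elimination ideal `ι⁻¹(IG2)` is generated by the two elements
`θ₁θ₃ − A₁₂A₂A₂₃θ₂ − λ₂₄A₁₂A₂₃A₃₄A₄₁ − A₃₄A₄A₄₁θ₄` and
`θ₂θ₄ − A₄₁A₁A₁₂θ₁ − λ₁₃A₁₂A₂₃A₃₄A₄₁ − A₂₃A₃A₃₄θ₃`: the Gorenstein projection of `X_{G₂}`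
eliminating `θ₁₂, θ₂₃, θ₃₄, θ₄₁` is a complete intersection of codimension 2. -/
theorem G2_projection_CI2 :
    Ideal.comap (MvPolynomial.rename emb18 : R14 →ₐ[ℂ] R18) IG2 =
      Ideal.span {proj18a, proj18b} := by
  refine le_antisymm (fun p hp => ?_) span_proj18_le_comap
  obtain ⟨n, q, h⟩ := exists_prodA_pow_mul_sub_mem p
  have hp0 : toFrac (rename emb18 p) = 0 := IG2_le_ker_toFrac hp
  have h0 : toFrac (rename emb18 (prodA ^ n * p - killLam q)) = 0 :=
    IG2_le_ker_toFrac (span_proj18_le_comap h)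
  have hq : killLam q = 0 := by
    rw [map_sub, map_sub, map_mul, map_mul, hp0, mul_zero, zero_sub, neg_eq_zero,
      toFrac_rename_killLam] at h0
    exact (FaithfulSMul.algebraMap_eq_zero_iff _ _).1 h0
  rw [hq, sub_zero] at h
  exact mem_span_of_prodA_pow_mul_mem n h
end

section
/- In the polynomial ring ℂ[θ₁, θ₂, θ₃, θ₄, θ₅, A₁, A₂, A₃, A₄, A₅], let I_{A₂} be the ideal generated by the five quadrics θ_{i−1}θ_{i+1} − A_iθ_i − A_{i−2}A_{i+2} for i = 1, …, 5, with all indices taken modulo 5. Then I_{A₂} is a prime ideal and the quotient ring ℂ[θ₁, …, θ₅, A₁, …, A₅]/I_{A₂} has Krull dimension 7; that is, the A₂ cluster variety V(I_{A₂}) ⊆ ℂ¹⁰ is a 7-dimensional irreducible affine variety of codimension 3 (the affine cone over the Plücker-embedded Grassmannian Gr(2,5)). -/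
/-!
The A₂ cluster variety: `RA2 = ℂ[θ₁, …, θ₅, A₁, …, A₅]`, with `θᵢ = X (i-1)` and
`Aᵢ = X (i+4)`.  Indices `i : Fin 5` stand for the indices 1,…,5 taken modulo 5, with
`Fin 5` (wrap-around) addition; in particular `i - 1 = i + 4` and `i - 2 = i + 3`.
-/

open MvPolynomial

noncomputable section

abbrev RA2 : Type := MvPolynomial (Fin 10) ℂ

/-- The cluster variables θ₁, …, θ₅. -/
def tA : Fin 5 → RA2 := ![X 0, X 1, X 2, X 3, X 4]

/-- The coefficients A₁, …, A₅. -/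
def cA : Fin 5 → RA2 := ![X 5, X 6, X 7, X 8, X 9]

/-- The five quadrics `θ_{i−1}θ_{i+1} − A_iθ_i − A_{i−2}A_{i+2}`, indices modulo 5. -/
def gA (i : Fin 5) : RA2 := tA (i + 4) * tA (i + 1) - cA i * tA i - cA (i + 3) * cA (i + 2)

/-- The A₂ cluster ideal. -/
def IA2 : Ideal RA2 := Ideal.span (Set.range gA)

end

/-! ### Krull dimension along chains of primes -/

theorem ringKrullDim_quotient_add_one_le {R : Type*} [CommRing R] {p q : Ideal R} [p.IsPrime]
    (h : p < q) : ringKrullDim (R ⧸ q) + 1 ≤ ringKrullDim (R ⧸ p) := by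
  obtain ⟨x, hxq, hxp⟩ := SetLike.exists_of_lt h
  refine ringKrullDim_succ_le_of_surjective (Ideal.Quotient.factor h.le)
    (Ideal.Quotient.factor_surjective h.le) (r := Ideal.Quotient.mk p x) ?_ ?_
  · rwa [mem_nonZeroDivisors_iff_ne_zero, Ne, Ideal.Quotient.eq_zero_iff_mem]
  · rwa [Ideal.Quotient.factor_mk, Ideal.Quotient.eq_zero_iff_mem]

theorem ringKrullDim_quotient_add_natCast_le {R : Type*} [CommRing R] (p : ℕ → Ideal R)
    (hp : ∀ i, (p i).IsPrime) (n : ℕ) (h : ∀ i < n, p i < p (i + 1)) :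
    ringKrullDim (R ⧸ p n) + n ≤ ringKrullDim (R ⧸ p 0) := by
  induction n with
  | zero => simp
  | succ n ih =>
    have := hp n
    calc ringKrullDim (R ⧸ p (n + 1)) + (n + 1 : ℕ)
        = ringKrullDim (R ⧸ p (n + 1)) + 1 + n := by
          push_cast
          rw [add_assoc, add_comm (n : WithBot ℕ∞)]
      _ ≤ ringKrullDim (R ⧸ p n) + n := by
        gcongr
        exact ringKrullDim_quotient_add_one_le (h n n.lt_succ_self)
      _ ≤ _ := ih fun i hi => h i (hi.trans n.lt_succ_self)

namespace MvPolynomial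

/-- Substitute the constants `w i` for the variables `X i` with `i < j`. -/
noncomputable def specialize {n : ℕ} {D : Type*} [CommRing D] (w : Fin n → D) (j : ℕ) :
    MvPolynomial (Fin n) D →ₐ[D] MvPolynomial (Fin n) D :=
  aeval fun i => if i.val < j then C (w i) else X i

variable {n : ℕ} {D : Type*} [CommRing D] (w : Fin n → D)

theorem specialize_X_of_lt {j : ℕ} {i : Fin n} (h : i.val < j) :
    specialize w j (X i) = C (w i) := by
  simp [specialize, h]

theorem specialize_X_of_le {j : ℕ} {i : Fin n} (h : j ≤ i.val) :
    specialize w j (X i) = X i := by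
  simp [specialize, h]

theorem specialize_C (j : ℕ) (a : D) : specialize w j (C a) = C a :=
  (specialize w j).commutes a

theorem specialize_specialize (j : ℕ) (f : MvPolynomial (Fin n) D) :
    specialize w (j + 1) (specialize w j f) = specialize w (j + 1) f := by
  rw [← AlgHom.comp_apply]
  congr 1
  ext i : 1
  obtain h | h := lt_or_ge i.val j
  · rw [AlgHom.comp_apply, specialize_X_of_lt w h, specialize_X_of_lt w (h.trans j.lt_succ_self),
      specialize_C]
  · rw [AlgHom.comp_apply, specialize_X_of_le w h]

theorem specialize_zero (f : MvPolynomial (Fin n) D) : specialize w 0 f = f := by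
  suffices specialize w 0 = AlgHom.id D _ by rw [this, AlgHom.id_apply]
  ext i : 1
  rw [specialize_X_of_le w (Nat.zero_le _), AlgHom.id_apply]

theorem specialize_last (f : MvPolynomial (Fin n) D) :
    specialize w n f = C (eval w f) := by
  suffices specialize w n = (Algebra.ofId D _).comp (aeval w) by
    rw [this]; rfl
  ext i : 1
  rw [specialize_X_of_lt w i.isLt]
  simp [Algebra.ofId_apply]

/-- Specializing the variables of a map into a polynomial ring over a domain one after another
makes the dimension of the image drop by at least one each time, as long as the image of `r j`
is a multiple of `X j - C (w j)` which survives the first `j` specializations. -/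
theorem ringKrullDim_quotient_ker_eval_add_le [IsDomain D] {R : Type*} [CommRing R]
    (f : R →+* MvPolynomial (Fin n) D) (r : Fin n → R) (g : Fin n → MvPolynomial (Fin n) D)
    (hr : ∀ j, f (r j) = g j * (X j - C (w j))) (hg : ∀ j : Fin n, specialize w j (g j) ≠ 0) :
    ringKrullDim (R ⧸ RingHom.ker ((eval w).comp f)) + n ≤ ringKrullDim (R ⧸ RingHom.ker f) := by
  let p : ℕ → Ideal R := fun j => RingHom.ker ((specialize w j).toRingHom.comp f)
  have mem_p (j : ℕ) (x : R) : x ∈ p j ↔ specialize w j (f x) = 0 := Iff.rfl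
  have h0 : p 0 = RingHom.ker f := by
    ext x
    rw [mem_p, specialize_zero, RingHom.mem_ker]
  have hn : p n = RingHom.ker ((eval w).comp f) := by
    ext x
    rw [mem_p, specialize_last, RingHom.mem_ker, C_eq_zero, RingHom.comp_apply]
  rw [← h0, ← hn]
  refine ringKrullDim_quotient_add_natCast_le p (fun i => RingHom.ker_isPrime _) n fun j hj => ?_
  refine SetLike.lt_iff_le_and_exists.2 ⟨fun x hx => ?_, r ⟨j, hj⟩, ?_, ?_⟩
  · rw [mem_p] at hx ⊢
    rw [← specialize_specialize, hx, map_zero]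
  · rw [mem_p, hr, map_mul, map_sub, specialize_C, specialize_X_of_lt w j.lt_succ_self, sub_self,
      mul_zero]
  · rw [mem_p, hr, map_mul, map_sub, specialize_C, specialize_X_of_le w (i := ⟨j, hj⟩) le_rfl]
    refine mul_ne_zero (hg ⟨j, hj⟩) fun h => ?_
    have := congrArg (eval fun _ => w ⟨j, hj⟩ + 1) h
    simp at this

end MvPolynomial

/-! ### Linear independence of Hahn series with distinct orders -/

theorem HahnSeries.eq_zero_of_sum_C_mul_eq_zero {Γ R : Type*} [AddCommGroup Γ] [LinearOrder Γ]
    [IsOrderedAddMonoid Γ] [CommRing R] [IsDomain R] (m : Γ → HahnSeries Γ R)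
    (hm : ∀ v, m v ≠ 0) (hord : ∀ v, (m v).order = v) (c : Γ →₀ R)
    (h : (c.sum fun v a => HahnSeries.C a * m v) = 0) : c = 0 := by
  by_contra hc
  have hne : c.support.Nonempty := Finsupp.support_nonempty_iff.2 hc
  set v₀ := c.support.min' hne
  have hv₀ : v₀ ∈ c.support := Finset.min'_mem _ _
  have hcoeff := congrArg (fun x => HahnSeries.coeff x v₀) h
  simp only [Finsupp.sum, HahnSeries.coeff_sum, HahnSeries.C_mul_eq_smul, HahnSeries.coeff_smul,
    HahnSeries.coeff_zero] at hcoeff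
  rw [Finset.sum_eq_single_of_mem v₀ hv₀] at hcoeff
  · refine mul_ne_zero (Finsupp.mem_support_iff.1 hv₀) ?_ hcoeff
    rw [Ne]
    nth_rewrite 2 [← hord v₀]
    rw [HahnSeries.coeff_order_eq_zero]
    exact hm v₀
  · intro v hv hne'
    rw [HahnSeries.coeff_eq_zero_of_lt_order, smul_zero]
    rw [hord]
    exact lt_of_le_of_ne (Finset.min'_le _ _ hv) hne'.symm

/-! ### The Laurent expansion of the cluster variables -/

namespace A2Cluster

noncomputable section

/-- A domain containing the Laurent polynomials in `θ₁, θ₂` over `ℂ[A₁, …, A₅]`, with its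
lexicographic valuation. -/
abbrev Laurent : Type := HahnSeries (ℤ ×ₗ ℤ) (MvPolynomial (Fin 5) ℂ)

/-- The Laurent monomial `θ₁ ^ a * θ₂ ^ b`. -/
def mono (a b : ℤ) : Laurent := HahnSeries.single (toLex (a, b)) 1

/-- The coefficient variable `A_{i+1}`. -/
def coef (i : Fin 5) : Laurent := HahnSeries.C (X i)

theorem mono_mul (a b c d : ℤ) : mono a b * mono c d = mono (a + c) (b + d) := by
  simp only [mono, HahnSeries.single_mul_single, mul_one]
  rfl

theorem mono_zero : mono 0 0 = 1 := rfl

/-- The Laurent expansions of `θ₁, …, θ₅, A₁, …, A₅` in the initial cluster `θ₁, θ₂`. -/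
def expansion : Fin 10 → Laurent :=
  ![mono 1 0, mono 0 1,
    mono (-1) 0 * (coef 3 * coef 4 + coef 1 * mono 0 1),
    mono (-1) (-1) * (coef 2 * coef 3 * coef 4 +
      (coef 1 * coef 2 * mono 0 1 + coef 0 * coef 4 * mono 1 0)),
    mono 0 (-1) * (coef 2 * coef 3 + coef 0 * mono 1 0),
    coef 0, coef 1, coef 2, coef 3, coef 4]

/-- The homomorphism sending each variable to its Laurent expansion. -/
def expand : RA2 →ₐ[ℂ] Laurent := aeval expansion

theorem mono_inv_one : mono (-1) 0 * mono 1 0 = 1 := by rw [mono_mul]; rfl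

theorem mono_inv_two : mono 0 (-1) * mono 0 1 = 1 := by rw [mono_mul]; rfl

theorem mono_neg_neg : mono (-1) (-1) = mono (-1) 0 * mono 0 (-1) := by rw [mono_mul]; rfl

theorem expand_gA (i : Fin 5) : expand (gA i) = 0 := by
  have h₁ := mono_inv_one
  have h₂ := mono_inv_two
  have h₃ := mono_neg_neg
  fin_cases i <;>
    simp [gA, tA, cA, expand, expansion, h₃] <;> grind

theorem IA2_le_ker_expand : IA2 ≤ RingHom.ker expand := by
  rw [IA2, Ideal.span_le]
  rintro _ ⟨i, rfl⟩
  exact expand_gA i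

theorem orderTop_C {a : MvPolynomial (Fin 5) ℂ} (ha : a ≠ 0) :
    (HahnSeries.C a : Laurent).orderTop = ((0 : ℤ ×ₗ ℤ) : WithTop (ℤ ×ₗ ℤ)) :=
  HahnSeries.orderTop_single ha

/-- `f` is nonzero of order `(x, y)`. -/
def HasOrder (f : Laurent) (x y : ℤ) : Prop :=
  f.orderTop = ((toLex (x, y) : ℤ ×ₗ ℤ) : WithTop (ℤ ×ₗ ℤ))

theorem HasOrder.ne_zero {f : Laurent} {x y : ℤ} (h : HasOrder f x y) : f ≠ 0 := by
  rintro rfl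
  simp [HasOrder] at h

theorem HasOrder.order_eq {f : Laurent} {x y : ℤ} (h : HasOrder f x y) :
    f.order = toLex (x, y) := by
  have h0 := h.ne_zero
  rw [HasOrder, ← HahnSeries.order_eq_orderTop_of_ne_zero h0] at h
  exact WithTop.coe_injective h

theorem HasOrder.mul {f g : Laurent} {x y z w : ℤ} (hf : HasOrder f x y) (hg : HasOrder g z w) :
    HasOrder (f * g) (x + z) (y + w) := by
  rw [HasOrder, HahnSeries.orderTop_mul, hf, hg, ← WithTop.coe_add]
  rfl

theorem hasOrder_mono (x y : ℤ) : HasOrder (mono x y) x y :=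
  HahnSeries.orderTop_single one_ne_zero

theorem HasOrder.pow {f : Laurent} {x y : ℤ} (h : HasOrder f x y) (n : ℕ) :
    HasOrder (f ^ n) (n * x) (n * y) := by
  induction n with
  | zero => simpa [mono_zero] using hasOrder_mono 0 0
  | succ n ih =>
    rw [pow_succ]
    convert ih.mul h using 1 <;> push_cast <;> ring

theorem HasOrder.add_of_lt {f g : Laurent} {x y : ℤ} (h : HasOrder f x y)
    (hg : ((toLex (x, y) : ℤ ×ₗ ℤ) : WithTop (ℤ ×ₗ ℤ)) < g.orderTop) :
    HasOrder (f + g) x y := by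
  rw [HasOrder, HahnSeries.orderTop_add_eq_left (by rwa [h]), h]

theorem hasOrder_coef (i : Fin 5) : HasOrder (coef i) 0 0 := orderTop_C (X_ne_zero i)

theorem lt_orderTop_of_hasOrder {g : Laurent} {x y : ℤ} (h : HasOrder g x y)
    (hxy : (toLex (0, 0) : ℤ ×ₗ ℤ) < toLex (x, y)) :
    ((toLex (0, 0) : ℤ ×ₗ ℤ) : WithTop (ℤ ×ₗ ℤ)) < g.orderTop := by
  rw [h]
  exact WithTop.coe_lt_coe.2 hxy

theorem hasOrder_expansion_two : HasOrder (expansion 2) (-1) 0 :=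
  (hasOrder_mono (-1) 0).mul <| ((hasOrder_coef 3).mul (hasOrder_coef 4)).add_of_lt <|
    lt_orderTop_of_hasOrder ((hasOrder_coef 1).mul (hasOrder_mono 0 1)) (by decide)

theorem hasOrder_expansion_three : HasOrder (expansion 3) (-1) (-1) := by
  refine (hasOrder_mono (-1) (-1)).mul (z := 0) (w := 0) <|
    (((hasOrder_coef 2).mul (hasOrder_coef 3)).mul (hasOrder_coef 4)).add_of_lt <|
      lt_of_lt_of_le (lt_min ?_ ?_) HahnSeries.min_orderTop_le_orderTop_add
  · exact lt_orderTop_of_hasOrder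
      (((hasOrder_coef 1).mul (hasOrder_coef 2)).mul (hasOrder_mono 0 1)) (by decide)
  · exact lt_orderTop_of_hasOrder
      (((hasOrder_coef 0).mul (hasOrder_coef 4)).mul (hasOrder_mono 1 0)) (by decide)

theorem hasOrder_expansion_four : HasOrder (expansion 4) 0 (-1) :=
  (hasOrder_mono 0 (-1)).mul <| ((hasOrder_coef 2).mul (hasOrder_coef 3)).add_of_lt <|
    lt_orderTop_of_hasOrder ((hasOrder_coef 0).mul (hasOrder_mono 1 0)) (by decide)

/-! ### Standard monomials -/

/-- The monomial `θ₁ ^ a * θ₂ ^ b * θ₃ ^ c * θ₄ ^ d * θ₅ ^ e`. -/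
def thetaMonomial (a b c d e : ℕ) : RA2 := X 0 ^ a * X 1 ^ b * X 2 ^ c * X 3 ^ d * X 4 ^ e

theorem hasOrder_expand_thetaMonomial (a b c d e : ℕ) :
    HasOrder (expand (thetaMonomial a b c d e)) (a - c - d) (b - d - e) := by
  have h := (((((hasOrder_mono 1 0).pow a).mul ((hasOrder_mono 0 1).pow b)).mul
    (hasOrder_expansion_two.pow c)).mul (hasOrder_expansion_three.pow d)).mul
    (hasOrder_expansion_four.pow e)
  convert h using 1
  · simp [thetaMonomial, expand, expansion]
  · ring
  · ring

/-- The cluster monomial with g-vector `v`. -/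
def clusterMonomial (v : ℤ ×ₗ ℤ) : RA2 :=
  thetaMonomial (ofLex v).1.toNat (ofLex v).2.toNat
    ((-(ofLex v).1).toNat - (-(ofLex v).2).toNat)
    (min (-(ofLex v).1).toNat (-(ofLex v).2).toNat)
    ((-(ofLex v).2).toNat - (-(ofLex v).1).toNat)

theorem hasOrder_expand_clusterMonomial (v : ℤ ×ₗ ℤ) :
    HasOrder (expand (clusterMonomial v)) (ofLex v).1 (ofLex v).2 := by
  rw [clusterMonomial]
  convert hasOrder_expand_thetaMonomial (ofLex v).1.toNat (ofLex v).2.toNat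
    ((-(ofLex v).1).toNat - (-(ofLex v).2).toNat)
    (min (-(ofLex v).1).toNat (-(ofLex v).2).toNat)
    ((-(ofLex v).2).toNat - (-(ofLex v).1).toNat) using 1 <;> omega

theorem thetaMonomial_eq_clusterMonomial {a b c d e : ℕ} (h₁ : a = 0 ∨ c = 0) (h₂ : b = 0 ∨ d = 0)
    (h₃ : c = 0 ∨ e = 0) (h₄ : d = 0 ∨ a = 0) (h₅ : e = 0 ∨ b = 0) :
    thetaMonomial a b c d e =
      clusterMonomial (toLex ((a : ℤ) - c - d, (b : ℤ) - d - e)) := by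
  simp only [clusterMonomial, ofLex_toLex]
  congr 1 <;> omega

/-- The inclusion of the coefficient ring `ℂ[A₁, …, A₅]`. -/
def coeffHom : MvPolynomial (Fin 5) ℂ →ₐ[ℂ] RA2 := aeval cA

theorem expand_coeffHom (a : MvPolynomial (Fin 5) ℂ) :
    expand (coeffHom a) = HahnSeries.C a := by
  induction a using MvPolynomial.induction_on with
  | C z => simp [coeffHom, expand, HahnSeries.algebraMap_apply, algebraMap_eq]
  | add p q hp hq => simp only [map_add, hp, hq]
  | mul_X p i hp =>
    have hX : expand (coeffHom (X i)) = HahnSeries.C (X i) := by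
      rw [coeffHom, aeval_X]
      fin_cases i <;> simp [cA, expand, expansion, coef]
    rw [map_mul, map_mul, hp, hX, map_mul]

/-- The `ℂ[A₁, …, A₅]`-linear combination of cluster monomials with coefficients `c`. -/
def clusterSum (c : (ℤ ×ₗ ℤ) →₀ MvPolynomial (Fin 5) ℂ) : RA2 :=
  c.sum fun v a => coeffHom a * clusterMonomial v

theorem eq_zero_of_expand_clusterSum_eq_zero {c : (ℤ ×ₗ ℤ) →₀ MvPolynomial (Fin 5) ℂ}
    (h : expand (clusterSum c) = 0) : c = 0 := by
  refine HahnSeries.eq_zero_of_sum_C_mul_eq_zero (fun v => expand (clusterMonomial v))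
    (fun v => (hasOrder_expand_clusterMonomial v).ne_zero)
    (fun v => (hasOrder_expand_clusterMonomial v).order_eq) c ?_
  rw [← h, clusterSum, map_finsuppSum]
  simp only [map_mul, expand_coeffHom]

/-- `f` is congruent modulo `IA2` to a combination of cluster monomials. -/
def IsReducible (f : RA2) : Prop := ∃ c, f - clusterSum c ∈ IA2

theorem isReducible_clusterMonomial (v : ℤ ×ₗ ℤ) : IsReducible (clusterMonomial v) :=
  ⟨Finsupp.single v 1, by simp [clusterSum]⟩

theorem IsReducible.add {f g : RA2} (hf : IsReducible f) (hg : IsReducible g) :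
    IsReducible (f + g) := by
  obtain ⟨c, hc⟩ := hf
  obtain ⟨d, hd⟩ := hg
  refine ⟨c + d, ?_⟩
  have : clusterSum (c + d) = clusterSum c + clusterSum d :=
    Finsupp.sum_add_index' (by simp) (by simp [add_mul])
  rw [this, add_sub_add_comm]
  exact add_mem hc hd

theorem IsReducible.coeffHom_mul {f : RA2} (hf : IsReducible f) (a : MvPolynomial (Fin 5) ℂ) :
    IsReducible (coeffHom a * f) := by
  obtain ⟨c, hc⟩ := hf
  refine ⟨a • c, ?_⟩
  have : clusterSum (a • c) = coeffHom a * clusterSum c := by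
    rw [clusterSum, Finsupp.sum_smul_index' (by simp), clusterSum, Finsupp.mul_sum]
    simp only [smul_eq_mul, map_mul, mul_assoc]
  rw [this, ← mul_sub]
  exact Ideal.mul_mem_left _ _ hc

theorem IsReducible.congr {f g : RA2} (hg : IsReducible g) (h : f - g ∈ IA2) :
    IsReducible f := by
  obtain ⟨c, hc⟩ := hg
  exact ⟨c, by simpa using add_mem h hc⟩

/-- The exchange relations lower the degree in the cluster variables. -/
theorem IsReducible.of_exchange (i : Fin 5) {f g : RA2} (hf : f = tA (i + 4) * tA (i + 1) * g)
    (h₁ : IsReducible (tA i * g)) (h₂ : IsReducible g) : IsReducible f := by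
  refine ((h₁.coeffHom_mul (X i)).add (h₂.coeffHom_mul (X (i + 3) * X (i + 2)))).congr ?_
  have : f - (coeffHom (X i) * (tA i * g) + coeffHom (X (i + 3) * X (i + 2)) * g) = gA i * g := by
    simp only [hf, coeffHom, map_mul, aeval_X, gA]
    ring
  rw [this]
  exact Ideal.mul_mem_right _ _ (Ideal.subset_span ⟨i, rfl⟩)

theorem isReducible_thetaMonomial (a b c d e : ℕ) : IsReducible (thetaMonomial a b c d e) := by
  induction hn : a + b + c + d + e using Nat.strong_induction_on generalizing a b c d e with
  | _ n ih =>
  subst hn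
  by_cases h₁ : a ≠ 0 ∧ c ≠ 0
  · obtain ⟨a, rfl⟩ := Nat.exists_eq_succ_of_ne_zero h₁.1
    obtain ⟨c, rfl⟩ := Nat.exists_eq_succ_of_ne_zero h₁.2
    refine IsReducible.of_exchange 1 (g := thetaMonomial a b c d e) ?_ ?_
      (ih _ (by omega) a b c d e rfl)
    · simp [thetaMonomial, tA]; ring
    · convert ih _ (by omega) a (b + 1) c d e rfl using 1
      simp [thetaMonomial, tA]; ring
  by_cases h₂ : b ≠ 0 ∧ d ≠ 0
  · obtain ⟨b, rfl⟩ := Nat.exists_eq_succ_of_ne_zero h₂.1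
    obtain ⟨d, rfl⟩ := Nat.exists_eq_succ_of_ne_zero h₂.2
    refine IsReducible.of_exchange 2 (g := thetaMonomial a b c d e) ?_ ?_
      (ih _ (by omega) a b c d e rfl)
    · simp [thetaMonomial, tA]; ring
    · convert ih _ (by omega) a b (c + 1) d e rfl using 1
      simp [thetaMonomial, tA]; ring
  by_cases h₃ : c ≠ 0 ∧ e ≠ 0
  · obtain ⟨c, rfl⟩ := Nat.exists_eq_succ_of_ne_zero h₃.1
    obtain ⟨e, rfl⟩ := Nat.exists_eq_succ_of_ne_zero h₃.2
    refine IsReducible.of_exchange 3 (g := thetaMonomial a b c d e) ?_ ?_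
      (ih _ (by omega) a b c d e rfl)
    · simp [thetaMonomial, tA]; ring
    · convert ih _ (by omega) a b c (d + 1) e rfl using 1
      simp [thetaMonomial, tA]; ring
  by_cases h₄ : d ≠ 0 ∧ a ≠ 0
  · obtain ⟨d, rfl⟩ := Nat.exists_eq_succ_of_ne_zero h₄.1
    obtain ⟨a, rfl⟩ := Nat.exists_eq_succ_of_ne_zero h₄.2
    refine IsReducible.of_exchange 4 (g := thetaMonomial a b c d e) ?_ ?_
      (ih _ (by omega) a b c d e rfl)
    · simp [thetaMonomial, tA]; ring
    · convert ih _ (by omega) a b c d (e + 1) rfl using 1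
      simp [thetaMonomial, tA]; ring
  by_cases h₅ : e ≠ 0 ∧ b ≠ 0
  · obtain ⟨e, rfl⟩ := Nat.exists_eq_succ_of_ne_zero h₅.1
    obtain ⟨b, rfl⟩ := Nat.exists_eq_succ_of_ne_zero h₅.2
    refine IsReducible.of_exchange 0 (g := thetaMonomial a b c d e) ?_ ?_
      (ih _ (by omega) a b c d e rfl)
    · simp [thetaMonomial, tA]; ring
    · convert ih _ (by omega) (a + 1) b c d e rfl using 1
      simp [thetaMonomial, tA]; ring
  rw [thetaMonomial_eq_clusterMonomial (by omega) (by omega) (by omega) (by omega) (by omega)]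
  exact isReducible_clusterMonomial _

theorem isReducible (f : RA2) : IsReducible f := by
  induction f using MvPolynomial.induction_on' with
  | monomial s a =>
    have : monomial s a = coeffHom (C a * X 0 ^ s 5 * X 1 ^ s 6 * X 2 ^ s 7 * X 3 ^ s 8 * X 4 ^ s 9)
        * thetaMonomial (s 0) (s 1) (s 2) (s 3) (s 4) := by
      rw [monomial_eq, Finsupp.prod_fintype _ _ (by simp)]
      simp [Fin.prod_univ_succ, coeffHom, cA, thetaMonomial, algebraMap_eq]
      ring
    rw [this]
    exact (isReducible_thetaMonomial _ _ _ _ _).coeffHom_mul _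
  | add p q hp hq => exact hp.add hq

theorem ker_expand : RingHom.ker expand = IA2 := by
  refine le_antisymm (fun f hf => ?_) IA2_le_ker_expand
  obtain ⟨c, hc⟩ := isReducible f
  have h := IA2_le_ker_expand hc
  rw [RingHom.mem_ker] at hf h
  rw [map_sub, hf, zero_sub, neg_eq_zero] at h
  simpa [eq_zero_of_expand_clusterSum_eq_zero h, clusterSum] using hc

/-! ### The dimension -/

/-- The generic Laurent expansion, with `θ₃, θ₄, θ₅` kept as independent variables. -/
def partialExpansion : RA2 →ₐ[ℂ] MvPolynomial (Fin 3) Laurent :=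
  aeval ![C (expansion 0), C (expansion 1), X 0, X 1, X 2, C (expansion 5), C (expansion 6),
    C (expansion 7), C (expansion 8), C (expansion 9)]

theorem ringKrullDim_quotient_add_three_le : ringKrullDim (RA2 ⧸ IA2) + 3 ≤ 10 := by
  have hker : RingHom.ker ((eval ![expansion 2, expansion 3, expansion 4]).comp
      partialExpansion.toRingHom) = IA2 := by
    have : (eval ![expansion 2, expansion 3, expansion 4]).comp partialExpansion.toRingHom =
        expand.toRingHom := by
      refine MvPolynomial.ringHom_ext (fun z => ?_) fun i => ?_
      · simp [partialExpansion, expand, MvPolynomial.algebraMap_apply]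
      · fin_cases i <;> simp [partialExpansion, expand]
    rw [this]
    exact ker_expand
  have h := ringKrullDim_quotient_ker_eval_add_le ![expansion 2, expansion 3, expansion 4]
    partialExpansion.toRingHom
    ![X 0 * X 2 - X 8 * X 9 - X 6 * X 1,
      X 0 * X 1 * X 3 - X 7 * X 8 * X 9 - X 6 * X 7 * X 1 - X 5 * X 9 * X 0,
      X 1 * X 4 - X 7 * X 8 - X 5 * X 0]
    ![C (mono 1 0), C (mono 1 0 * mono 0 1), C (mono 0 1)] ?_ ?_
  · rw [hker] at h
    refine h.trans ((ringKrullDim_quotient_le _).trans ?_)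
    rw [MvPolynomial.ringKrullDim_of_isNoetherianRing, ringKrullDim_eq_zero_of_field]
    simp
  · have h₁ := congrArg (C (σ := Fin 3)) mono_inv_one
    have h₂ := congrArg (C (σ := Fin 3)) mono_inv_two
    simp only [C_mul, C_1] at h₁ h₂
    intro j
    fin_cases j <;> simp [partialExpansion, expansion, mono_neg_neg] <;> grind
  · intro j
    fin_cases j <;> simp [(hasOrder_mono _ _).ne_zero]

/-- The Plücker coordinates of the `2 × 5` matrix with rows `(s, 0, x₃, x₄, x₅)` and
`(0, 1, y₃, y₄, y₅)`; the variables are `y₃, y₄, y₅, s, x₃, x₄, x₅`. -/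
def plucker : RA2 →ₐ[ℂ] MvPolynomial (Fin 7) ℂ :=
  aeval ![X 3 * X 0, X 3 * X 1, -X 5, -X 6, X 4 * X 2 - X 6 * X 0,
    X 5 * X 2 - X 6 * X 1, -X 4, X 3 * X 2, X 4 * X 1 - X 5 * X 0, X 3]

theorem IA2_le_ker_plucker : IA2 ≤ RingHom.ker plucker := by
  rw [IA2, Ideal.span_le]
  rintro _ ⟨i, rfl⟩
  rw [SetLike.mem_coe, RingHom.mem_ker]
  fin_cases i <;> simp [gA, tA, cA, plucker] <;> ring

theorem seven_le_ringKrullDim_quotient : 7 ≤ ringKrullDim (RA2 ⧸ IA2) := by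
  have h := ringKrullDim_quotient_ker_eval_add_le 0 plucker.toRingHom
    ![X 0, X 1, X 7, X 9, X 6, X 2, X 3] ![X 3, X 3, X 3, 1, -1, -1, -1] ?_ ?_
  · refine le_trans ?_ (h.trans (ringKrullDim_le_of_surjective
      (Ideal.Quotient.factor IA2_le_ker_plucker) (Ideal.Quotient.factor_surjective _)))
    have := RingHom.ker_isPrime ((eval (0 : Fin 7 → ℂ)).comp plucker.toRingHom)
    refine le_trans ?_ (add_le_add_left ringKrullDim_nonneg_of_nontrivial _)
    simp
  · intro j
    fin_cases j <;> simp [plucker]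
  · intro j
    fin_cases j <;> simp [specialize]

end

end A2Cluster

/-- The ideal `IA2` is prime and the quotient `RA2 ⧸ IA2` has Krull
dimension 7: the A₂ cluster variety `V(IA2) ⊆ ℂ¹⁰` is a 7-dimensional irreducible affine
variety of codimension 3 (the affine cone over the Plücker-embedded Grassmannian Gr(2,5)). -/
theorem A2_prime_and_dim : IA2.IsPrime ∧ ringKrullDim (RA2 ⧸ IA2) = 7 := by
  refine ⟨A2Cluster.ker_expand ▸ RingHom.ker_isPrime _, le_antisymm ?_
    A2Cluster.seven_le_ringKrullDim_quotient⟩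
  have h := A2Cluster.ringKrullDim_quotient_add_three_le
  generalize ringKrullDim (RA2 ⧸ IA2) = x at h ⊢
  induction x with
  | bot => exact bot_le
  | coe d =>
    replace h : d + 3 ≤ 7 + 3 := WithBot.coe_le_coe.1 h
    exact WithBot.coe_le_coe.2 ((ENat.add_le_add_iff_right (ENat.natCast_ne_top 3)).1 h)
end
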